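/- arXiv:1201.2020 — 2 statements merged into one kernel-verified Lean document; each statement's English description precedes it below -/
import Mathlib

section
/- The m-Tamari lattice T_n^(m) is EL-shellable: it is a bounded poset admitting an edge labeling such that every interval has a unique rising maximal chain that is lexicographically least among all maximal chains in that interval. -/
open scoped Classical

/-- An `m`-Dyck sequence of height `n` (0-indexed): weakly increasing with `a i ≤ m * i`. -/
def IsDyck (m n : ℕ) (a : Fin n → ℕ) : Prop :=
  Monotone a ∧ ∀ i : Fin n, a i ≤ m * i.val

/-- `k` is the last index of the primitive subsequence of `a` at position `i`. -/
def IsPrimEnd (m n : ℕ) (a : Fin n → ℕ) (i k : Fin n) : Prop :=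
  i ≤ k ∧ (∀ j : Fin n, i < j → j ≤ k → a j - a i < m * (j.val - i.val)) ∧
    (k.val + 1 = n ∨ ∃ h : k.val + 1 < n, m * (k.val + 1 - i.val) ≤ a ⟨k.val + 1, h⟩ - a i)

/-- The covering relation of the `m`-Tamari lattice: decrease the primitive
subsequence at a position `i+1` with `a i < a (i+1)` by one. -/
def Covers (m n : ℕ) (a b : Fin n → ℕ) : Prop :=
  ∃ (i : ℕ) (h : i + 1 < n) (k : Fin n),
    a ⟨i, Nat.lt_of_succ_lt h⟩ < a ⟨i + 1, h⟩ ∧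
    IsPrimEnd m n a ⟨i + 1, h⟩ k ∧
    b = fun j => if (⟨i + 1, h⟩ : Fin n) ≤ j ∧ j ≤ k then a j - 1 else a j

/-- The order of the `m`-Tamari lattice: reflexive-transitive closure of `Covers`. -/
def TamariLE (m n : ℕ) (a b : Fin n → ℕ) : Prop :=
  Relation.ReflTransGen (Covers m n) a b

/-- Extend a sequence on `Fin n` to `ℕ` by `0`. -/
noncomputable def extSeq (n : ℕ) (x : Fin n → ℕ) : ℕ → ℕ :=
  fun j => if h : j < n then x ⟨j, h⟩ else 0

/-- The least index at which `x` and `y` differ. -/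
noncomputable def diffIdx (n : ℕ) (x y : Fin n → ℕ) : ℕ :=
  sInf {j : ℕ | extSeq n x j ≠ extSeq n y j}

/-- The edge label `λ(x,y) = (j, x_j)`, `j` the least index where `x`,`y` differ. -/
noncomputable def lbl (n : ℕ) (x y : Fin n → ℕ) : ℕ × ℕ :=
  (diffIdx n x y, extSeq n x (diffIdx n x y))

/-- Strict order on labels: `(i,x) < (j,y)` iff `i < j`, or `i = j` and `x > y`. -/
def LblLT (p q : ℕ × ℕ) : Prop := p.1 < q.1 ∨ (p.1 = q.1 ∧ q.2 < p.2)

/-- Weak order on labels. -/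
def LblLE (p q : ℕ × ℕ) : Prop := p = q ∨ LblLT p q

/-- The sequence of edge labels of a chain. -/
noncomputable def labels (n : ℕ) (c : List (Fin n → ℕ)) : List (ℕ × ℕ) :=
  List.zipWith (lbl n) c c.tail

/-- A maximal chain in the interval `[a,b]`: a saturated chain of covers from `a` to `b`. -/
def IsMaxChn (m n : ℕ) (a b : Fin n → ℕ) (c : List (Fin n → ℕ)) : Prop :=
  c.Chain' (Covers m n) ∧ c.head? = some a ∧ c.getLast? = some b

/-- A chain is rising if its label sequence is strictly increasing. -/
noncomputable def Rising (n : ℕ) (c : List (Fin n → ℕ)) : Prop :=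
  (labels n c).Chain' LblLT

/-- A chain is falling if its label sequence is weakly decreasing. -/
noncomputable def Falling (n : ℕ) (c : List (Fin n → ℕ)) : Prop :=
  (labels n c).Chain' (fun p q => LblLE q p)

/-- Lexicographic comparison of label sequences. -/
def LexLE (l₁ l₂ : List (ℕ × ℕ)) : Prop := l₁ = l₂ ∨ List.Lex LblLT l₁ l₂

/-- Decrease by one the entries of `a` with index in `[i, k]`. -/
def decr {n : ℕ} (a : Fin n → ℕ) (i k : Fin n) : Fin n → ℕ :=
  fun j => if i.val ≤ j.val ∧ j.val ≤ k.val then a j - 1 else a j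

/-- The position `i` is an ascent of `a`: it has a predecessor with a smaller entry. -/
def Ascent {n : ℕ} (a : Fin n → ℕ) (i : Fin n) : Prop :=
  ∃ p : Fin n, p.val + 1 = i.val ∧ a p < a i

/-- A subtraction-free form of `IsPrimEnd`. -/
def PrimEnd (m : ℕ) {n : ℕ} (a : Fin n → ℕ) (i k : Fin n) : Prop :=
  i.val ≤ k.val ∧
    (∀ j : Fin n, i.val < j.val → j.val ≤ k.val → a j + m * i.val < a i + m * j.val) ∧
    ∀ j : Fin n, j.val = k.val + 1 → a i + m * j.val ≤ a j + m * i.val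

theorem isPrimEnd_iff {m n : ℕ} {a : Fin n → ℕ} (ha : Monotone a) (i k : Fin n) :
    IsPrimEnd m n a i k ↔ PrimEnd m a i k := by
  have key : ∀ j : Fin n, i.val ≤ j.val → a i ≤ a j ∧ m * i.val ≤ m * j.val :=
    fun j hj => ⟨ha (Fin.le_def.2 hj), Nat.mul_le_mul_left m hj⟩
  unfold IsPrimEnd PrimEnd
  simp only [Fin.le_def, Fin.lt_def, Nat.mul_sub]
  refine and_congr_right fun hik => and_congr ?_ ?_
  · refine forall_congr' fun j => forall_congr' fun hj => forall_congr' fun _ => ?_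
    have := key j hj.le
    omega
  · constructor
    · rintro (h | ⟨h, hle⟩) j hj
      · omega
      · obtain rfl : j = ⟨k.val + 1, h⟩ := Fin.ext hj
        have := key _ (show i.val ≤ (⟨k.val + 1, h⟩ : Fin n).val by simp; omega)
        simp only at this ⊢
        omega
    · intro H
      by_cases h : k.val + 1 < n
      · have := key ⟨k.val + 1, h⟩ (by simp; omega)
        have := H ⟨k.val + 1, h⟩ rfl
        simp only at *
        exact Or.inr ⟨h, by omega⟩
      · have := k.isLt
        exact Or.inl (by omega)

theorem covers_iff {m n : ℕ} {a : Fin n → ℕ} (ha : Monotone a) (b : Fin n → ℕ) :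
    Covers m n a b ↔ ∃ i k, Ascent a i ∧ PrimEnd m a i k ∧ b = decr a i k := by
  unfold Covers
  constructor
  · rintro ⟨i, h, k, hlt, hk, rfl⟩
    exact ⟨⟨i + 1, h⟩, k, ⟨_, rfl, hlt⟩, (isPrimEnd_iff ha _ _).1 hk, rfl⟩
  · rintro ⟨⟨i, hi⟩, k, ⟨p, hp, hlt⟩, hk, rfl⟩
    obtain rfl : p.val + 1 = i := hp
    exact ⟨p.val, hi, k, hlt, (isPrimEnd_iff ha _ _).2 hk, rfl⟩

theorem PrimEnd.unique {m n : ℕ} {a : Fin n → ℕ} {i k k' : Fin n}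
    (h : PrimEnd m a i k) (h' : PrimEnd m a i k') : k = k' := by
  have aux : ∀ {k k' : Fin n}, PrimEnd m a i k → PrimEnd m a i k' → k'.val ≤ k.val := by
    intro k k' h h'
    by_contra hlt
    have hk := k'.isLt
    have h1 := h.2.2 ⟨k.val + 1, by omega⟩ rfl
    have h0 := h.1
    have h2 := h'.2.1 ⟨k.val + 1, by omega⟩ (by simp; omega) (by simp; omega)
    omega
  exact Fin.ext (le_antisymm (aux h' h) (aux h h'))

theorem exists_primEnd (m : ℕ) {n : ℕ} (a : Fin n → ℕ) (i : Fin n) :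
    ∃ k, PrimEnd m a i k := by
  let S : Finset (Fin n) := Finset.univ.filter fun k => i.val ≤ k.val ∧
    ∀ j : Fin n, i.val < j.val → j.val ≤ k.val → a j + m * i.val < a i + m * j.val
  have hS : S.Nonempty := ⟨i, by simp only [S, Finset.mem_filter]; grind⟩
  obtain ⟨k, hk, hmax⟩ := S.exists_max_image (fun k => k.val) hS
  simp only [S, Finset.mem_filter, Finset.mem_univ, true_and] at hk hmax
  refine ⟨k, hk.1, hk.2, fun j hj => ?_⟩
  by_contra hlt
  have := hmax j ⟨by omega, fun l hil hlj => ?_⟩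
  · omega
  · rcases Nat.lt_or_ge k.val l.val with h | h
    · obtain rfl : l = j := Fin.ext (by omega)
      omega
    · exact hk.2 l hil h

theorem Ascent.pos {n : ℕ} {a : Fin n → ℕ} {i : Fin n} (h : Ascent a i) : 0 < a i := by
  obtain ⟨p, _, hp⟩ := h
  omega

theorem Ascent.lt {n : ℕ} {a : Fin n → ℕ} {i l : Fin n} (ha : Monotone a) (h : Ascent a i)
    (hl : l.val < i.val) : a l < a i := by
  obtain ⟨p, hp, hlt⟩ := h
  exact (ha (Fin.le_def.2 (by omega))).trans_lt hlt

theorem decr_of_lt {n : ℕ} (a : Fin n → ℕ) {i l : Fin n} (k : Fin n) (h : l.val < i.val) :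
    decr a i k l = a l :=
  if_neg (by omega)

theorem decr_le {n : ℕ} (a : Fin n → ℕ) (i k l : Fin n) : decr a i k l ≤ a l := by
  unfold decr
  split_ifs <;> omega

theorem decr_self {n : ℕ} (a : Fin n → ℕ) {i k : Fin n} (h : i.val ≤ k.val) :
    decr a i k i = a i - 1 :=
  if_pos ⟨le_rfl, h⟩

theorem monotone_decr {n : ℕ} {a : Fin n → ℕ} (ha : Monotone a) {i k : Fin n}
    (hi : Ascent a i) : Monotone (decr a i k) := by
  intro l l' hll
  have h1 := ha hll
  have h2 := fun h => hi.lt ha (l := l) h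
  have h3 := fun h : i.val ≤ l.val => ha (Fin.le_def.2 h)
  have h4 := fun h : i.val ≤ l'.val => ha (Fin.le_def.2 h)
  have h5 := hi.pos
  rw [Fin.le_def] at hll
  unfold decr
  split_ifs <;> grind

theorem isDyck_decr {m n : ℕ} {a : Fin n → ℕ} (ha : IsDyck m n a) {i k : Fin n}
    (hi : Ascent a i) : IsDyck m n (decr a i k) :=
  ⟨monotone_decr ha.1 hi, fun l => (decr_le a i k l).trans (ha.2 l)⟩

theorem Covers.isDyck {m n : ℕ} {a b : Fin n → ℕ} (h : Covers m n a b) (ha : IsDyck m n a) :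
    IsDyck m n b := by
  obtain ⟨i, k, hi, hk, rfl⟩ := (covers_iff ha.1 b).1 h
  exact isDyck_decr ha hi

theorem Covers.le {m n : ℕ} {a b : Fin n → ℕ} (h : Covers m n a b) : b ≤ a := by
  obtain ⟨i, hi, k, -, -, rfl⟩ := h
  intro j
  dsimp only
  split_ifs <;> omega

theorem Covers.sum_lt {m n : ℕ} {a b : Fin n → ℕ} (h : Covers m n a b) :
    ∑ j, b j < ∑ j, a j := by
  refine Finset.sum_lt_sum (fun j _ => h.le j) ?_
  obtain ⟨i, hi, k, hlt, hk, rfl⟩ := h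
  refine ⟨⟨i + 1, hi⟩, Finset.mem_univ _, ?_⟩
  have := hk.1
  simp only [le_refl, this, and_self, if_true]
  omega

theorem TamariLE.le {m n : ℕ} {a b : Fin n → ℕ} (h : TamariLE m n a b) : b ≤ a := by
  induction h with
  | refl => exact le_rfl
  | tail _ h ih => exact h.le.trans ih

/-- Decreasing at `i` first and at an earlier position `j` afterwards gives an element above the
one obtained by decreasing at `j` alone. -/
theorem tamariLE_decr_decr {m n : ℕ} {a : Fin n → ℕ} (ha : Monotone a) {i j ki kj : Fin n}
    (hji : j.val < i.val) (hj : Ascent a j) (hkj : PrimEnd m a j kj)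
    (hi : Ascent a i) (hki : PrimEnd m a i ki) :
    ∃ k, PrimEnd m (decr a i ki) j k ∧
      TamariLE m n (decr a j kj) (decr (decr a i ki) j k) := by
  have hpi := hi.pos
  have hpj := hj.pos
  have gi := fun (l : Fin n) (h : i.val ≤ l.val) => ha (Fin.le_def.2 h)
  have gj := fun (l : Fin n) (h : j.val ≤ l.val) => ha (Fin.le_def.2 h)
  have hmono : Monotone (decr a j kj) := monotone_decr ha hj
  -- `i` stays an ascent with the same primitive end after decreasing at `j`
  have hasc : Ascent (decr a j kj) i := by
    obtain ⟨p, hp, hlt⟩ := hi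
    refine ⟨p, hp, ?_⟩
    have := gj p
    unfold decr
    split_ifs <;> grind
  have hkikj : i.val ≤ kj.val → ki.val ≤ kj.val := by
    intro h
    by_contra hlt
    have hk := ki.isLt
    have h1 := hkj.2.2 ⟨kj.val + 1, by omega⟩ rfl
    have h2 := hki.2.1 ⟨kj.val + 1, by omega⟩ (by simp; omega) (by simp; omega)
    have h3 := hkj.2.1 i hji h
    omega
  have hprim : PrimEnd m (decr a j kj) i ki := by
    refine ⟨hki.1, fun l h1 h2 => ?_, fun l h1 => ?_⟩
    · have := hki.2.1 l h1 h2
      have := gi l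
      unfold decr
      split_ifs <;> omega
    · have := hki.2.2 l h1
      have := hki.1
      have := gi l
      unfold decr
      split_ifs <;> omega
  have hcov : Covers m n (decr a j kj) (decr (decr a j kj) i ki) :=
    (covers_iff hmono _).2 ⟨i, ki, hasc, hprim, rfl⟩
  have hkj0 := hkj.1
  have hki0 := hki.1
  by_cases hext : i.val = kj.val + 1 ∧ a i + m * j.val = a j + m * i.val
  · -- the primitive subsequence at `j` gets extended up to `ki`
    obtain ⟨hik, heq⟩ := hext
    refine ⟨ki, ⟨by omega, fun l h1 h2 => ?_, fun l h1 => ?_⟩, ?_⟩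
    · rcases Nat.lt_trichotomy l.val i.val with h | h | h
      · have := hkj.2.1 l h1 (by omega)
        unfold decr
        split_ifs <;> omega
      · obtain rfl : l = i := Fin.ext h
        unfold decr
        split_ifs <;> omega
      · have := hki.2.1 l h h2
        have := gi l
        unfold decr
        split_ifs <;> omega
    · have := hki.2.2 l h1
      unfold decr
      split_ifs <;> omega
    · have hmono' : Monotone (decr (decr a j kj) i ki) := monotone_decr hmono hasc
      refine Relation.ReflTransGen.tail (Relation.ReflTransGen.single hcov)
        ((covers_iff hmono' _).2 ⟨i, ki, ?_, ⟨hki0, fun l h1 h2 => ?_, fun l h1 => ?_⟩, ?_⟩)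
      · obtain ⟨p, hp, hlt⟩ := hi
        refine ⟨p, hp, ?_⟩
        have := gj p
        unfold decr
        split_ifs <;> grind
      · have := hprim.2.1 l h1 h2
        have : 0 < decr a j kj i := hasc.pos
        have := hmono (Fin.le_def.2 h1.le)
        rw [decr_self _ hki0, show decr (decr a j kj) i ki l = decr a j kj l - 1 from
          if_pos ⟨h1.le, h2⟩]
        omega
      · have := hprim.2.2 l h1
        rw [decr_self _ hki0, show decr (decr a j kj) i ki l = decr a j kj l from
          if_neg (by omega)]
        omega
      · funext l
        unfold decr
        split_ifs <;> omega
  · refine ⟨kj, ⟨hkj0, fun l h1 h2 => ?_, fun l h1 => ?_⟩, ?_⟩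
    · have := hkj.2.1 l h1 h2
      have := decr_le a i ki l
      rw [decr_of_lt a ki hji]
      omega
    · have := hkj.2.2 l h1
      rw [decr_of_lt a ki hji]
      unfold decr
      split_ifs with h
      · obtain rfl : l = i := Fin.ext (by omega)
        omega
      · omega
    · have hcomm : decr (decr a i ki) j kj = decr (decr a j kj) i ki := by
        funext l
        unfold decr
        split_ifs <;> omega
      rw [hcomm]
      exact Relation.ReflTransGen.single hcov

/-- Decreasing at the first position where `a` and `b` differ stays below `b`. -/
theorem tamariLE_decr_of_first_diff {m n : ℕ} {a b : Fin n → ℕ} (hab : TamariLE m n a b)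
    (ha : IsDyck m n a) {j k : Fin n} (hlt : ∀ l : Fin n, l.val < j.val → a l = b l)
    (hj : b j < a j) (hasc : Ascent a j) (hk : PrimEnd m a j k) :
    TamariLE m n (decr a j k) b := by
  unfold TamariLE at hab
  induction hab using Relation.ReflTransGen.head_induction_on generalizing k with
  | refl => omega
  | @head a a' h hab ih =>
    have ha' := h.isDyck ha
    have hle := TamariLE.le (m := m) hab
    obtain ⟨i, ki, hi, hki, rfl⟩ := (covers_iff ha.1 a').1 h
    rcases Nat.lt_trichotomy i.val j.val with hij | hij | hij
    · have h1 : b i ≤ decr a i ki i := hle i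
      rw [decr_self a hki.1] at h1
      have := hlt i hij
      have := hi.pos
      omega
    · obtain rfl : i = j := Fin.ext hij
      obtain rfl := hki.unique hk
      exact hab
    · obtain ⟨k', hk', hle'⟩ := tamariLE_decr_decr ha.1 hij hasc hk hi hki
      refine Relation.ReflTransGen.trans hle' (ih ha' (fun l hl => ?_) ?_ ?_ hk')
      · rw [decr_of_lt a ki (by omega), hlt l hl]
      · rwa [decr_of_lt a ki hij]
      · obtain ⟨p, hp, hpl⟩ := hasc
        exact ⟨p, hp, by rwa [decr_of_lt a ki hij, decr_of_lt a ki (by omega)]⟩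

theorem lbl_decr {m n : ℕ} {a : Fin n → ℕ} {i k : Fin n} (hi : Ascent a i)
    (hk : PrimEnd m a i k) : lbl n a (decr a i k) = (i.val, a i) := by
  have hd : diffIdx n a (decr a i k) = i.val := by
    apply le_antisymm
    · apply Nat.sInf_le
      have := hi.pos
      simp only [Set.mem_ofPred_eq, extSeq, i.isLt, dif_pos, Fin.eta, decr_self a hk.1]
      omega
    · refine le_csInf ⟨i.val, ?_⟩ fun l hl => ?_
      · have := hi.pos
        simp only [Set.mem_ofPred_eq, extSeq, i.isLt, dif_pos, Fin.eta, decr_self a hk.1]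
        omega
      · by_contra hlt
        apply hl
        simp only [extSeq]
        split_ifs with h
        · exact (decr_of_lt a k (by simpa using hlt)).symm
        · rfl
  simp [lbl, hd, extSeq]

/-- A Dyck sequence `a` strictly below `b` has a cover in the direction of the first difference. -/
theorem exists_first_diff {m n : ℕ} {a b : Fin n → ℕ} (ha : IsDyck m n a) (hb : IsDyck m n b)
    (hab : TamariLE m n a b) (hne : a ≠ b) :
    ∃ j k : Fin n, (∀ l : Fin n, l.val < j.val → a l = b l) ∧ b j < a j ∧ Ascent a j ∧
      PrimEnd m a j k ∧ TamariLE m n (decr a j k) b := by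
  have hle := hab.le
  let S : Finset (Fin n) := Finset.univ.filter fun j => a j ≠ b j
  have hS : S.Nonempty := by
    obtain ⟨j, hj⟩ := Function.ne_iff.1 hne
    exact ⟨j, by simpa [S] using hj⟩
  obtain ⟨j, hjS, hmin⟩ := S.exists_min_image (fun k => k.val) hS
  simp only [S, Finset.mem_filter, Finset.mem_univ, true_and] at hjS hmin
  have hlt : ∀ l : Fin n, l.val < j.val → a l = b l := by
    intro l hl
    by_contra h
    have := hmin l h
    omega
  have hj : b j < a j := lt_of_le_of_ne (hle j) (Ne.symm hjS)
  have hasc : Ascent a j := by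
    have hj0 : j.val ≠ 0 := by
      intro h
      have := ha.2 j
      rw [h] at this
      omega
    have hjn := j.isLt
    refine ⟨⟨j.val - 1, by omega⟩, by simp; omega, ?_⟩
    rw [hlt _ (by simp; omega)]
    exact (hb.1 (Fin.le_def.2 (by simp))).trans_lt hj
  obtain ⟨k, hk⟩ := exists_primEnd m a j
  exact ⟨j, k, hlt, hj, hasc, hk, tamariLE_decr_of_first_diff hab ha hlt hj hasc hk⟩

/-- Along a rising chain, the entries left of the current label no longer change. -/
theorem eq_of_rising {m n : ℕ} {b : Fin n → ℕ} (t : List (Fin n → ℕ)) (x : Fin n → ℕ)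
    (p : ℕ × ℕ) (hx : IsDyck m n x) (hc : List.IsChain (Covers m n) (x :: t))
    (hlast : (x :: t).getLast? = some b)
    (hr : List.IsChain LblLT (p :: List.zipWith (lbl n) (x :: t) t)) (l : Fin n)
    (hl : l.val < p.1) : x l = b l := by
  induction t generalizing x p with
  | nil =>
    obtain rfl : x = b := by simpa using hlast
    rfl
  | cons y t ih =>
    rw [List.isChain_cons_cons] at hc
    rw [List.zipWith_cons_cons, List.isChain_cons_cons] at hr
    rw [List.getLast?_cons_cons] at hlast
    have hy := hc.1.isDyck hx
    obtain ⟨i, k, hi, hk, rfl⟩ := (covers_iff hx.1 y).1 hc.1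
    have hli : l.val < i.val := by
      have := hr.1
      rw [lbl_decr hi hk] at this
      simp only [LblLT] at this
      omega
    rw [← ih _ _ hy hc.2 hlast hr.2 (by rw [lbl_decr hi hk]; exact hli), decr_of_lt x k hli]

theorem tamariLE_of_isChain {m n : ℕ} {b : Fin n → ℕ} (t : List (Fin n → ℕ)) (x : Fin n → ℕ)
    (hc : List.IsChain (Covers m n) (x :: t)) (hlast : (x :: t).getLast? = some b) :
    TamariLE m n x b := by
  induction t generalizing x with
  | nil =>
    obtain rfl : x = b := by simpa using hlast
    exact Relation.ReflTransGen.refl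
  | cons y t ih =>
    rw [List.isChain_cons_cons] at hc
    rw [List.getLast?_cons_cons] at hlast
    exact Relation.ReflTransGen.head hc.1 (ih y hc.2 hlast)

/-- A cover of `a` below `b` is at the first difference `j` of `a` and `b`, or further right. -/
theorem le_of_tamariLE_decr {m n : ℕ} {a b : Fin n → ℕ} {i j k : Fin n} (hi : Ascent a i)
    (hk : PrimEnd m a i k) (hle : TamariLE m n (decr a i k) b)
    (hlt : ∀ l : Fin n, l.val < j.val → a l = b l) : j.val ≤ i.val := by
  by_contra h
  have h1 : b i ≤ decr a i k i := hle.le i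
  rw [decr_self a hk.1, ← hlt i (by omega)] at h1
  have := hi.pos
  omega

/-- The labeling `lbl` is an EL-labeling. -/
theorem exists_unique_rising_lex_least {m n : ℕ} {b : Fin n → ℕ} (hb : IsDyck m n b) (N : ℕ) :
    ∀ a : Fin n → ℕ, ∑ j, a j = N → IsDyck m n a → TamariLE m n a b →
      ∃ t : List (Fin n → ℕ),
        (List.IsChain (Covers m n) (a :: t) ∧ (a :: t).getLast? = some b ∧
          List.IsChain LblLT (List.zipWith (lbl n) (a :: t) t)) ∧
        ∀ t' : List (Fin n → ℕ), List.IsChain (Covers m n) (a :: t') →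
          (a :: t').getLast? = some b →
          (List.IsChain LblLT (List.zipWith (lbl n) (a :: t') t') → t' = t) ∧
          (List.zipWith (lbl n) (a :: t) t = List.zipWith (lbl n) (a :: t') t' ∨
            List.Lex LblLT (List.zipWith (lbl n) (a :: t) t)
              (List.zipWith (lbl n) (a :: t') t')) := by
  induction N using Nat.strong_induction_on with
  | _ N ih =>
  rintro a rfl ha hab
  by_cases hne : a = b
  · subst hne
    refine ⟨[], by simp, fun t' hc hlast => ?_⟩
    cases t' with
    | nil => simp
    | cons y t =>
      rw [List.isChain_cons_cons] at hc
      rw [List.getLast?_cons_cons] at hlast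
      have h1 := hc.1.sum_lt
      have h2 := Finset.sum_le_sum fun j (_ : j ∈ Finset.univ) =>
        (tamariLE_of_isChain t y hc.2 hlast).le j
      omega
  · obtain ⟨j, k, hlt, hj, hasc, hk, hle⟩ := exists_first_diff ha hb hab hne
    have hcov : Covers m n a (decr a j k) := (covers_iff ha.1 _).2 ⟨j, k, hasc, hk, rfl⟩
    have hD := hcov.isDyck ha
    obtain ⟨t, ⟨hc, hlast, hr⟩, hmin⟩ := ih _ hcov.sum_lt _ rfl hD hle
    refine ⟨decr a j k :: t, ⟨List.isChain_cons_cons.2 ⟨hcov, hc⟩,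
      by rwa [List.getLast?_cons_cons], ?_⟩, fun t' hc' hlast' => ?_⟩
    · cases t with
      | nil => simp
      | cons z t =>
        rw [List.zipWith_cons_cons, List.zipWith_cons_cons, List.isChain_cons_cons]
        refine ⟨?_, by simpa using hr⟩
        rw [List.isChain_cons_cons] at hc
        rw [List.getLast?_cons_cons] at hlast
        have hzb := tamariLE_of_isChain t z hc.2 hlast
        obtain ⟨i, ki, hi, hki, rfl⟩ := (covers_iff hD.1 z).1 hc.1
        have hji : j.val ≤ i.val := le_of_tamariLE_decr hi hki hzb fun l hl => by
          rw [decr_of_lt a k hl, hlt l hl]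
        rw [lbl_decr hasc hk, lbl_decr hi hki]
        rcases hji.lt_or_eq with h | h
        · exact Or.inl h
        · obtain rfl : j = i := Fin.ext h
          refine Or.inr ⟨rfl, ?_⟩
          simp only [decr_self a hk.1]
          have := hasc.pos
          omega
    · cases t' with
      | nil =>
        obtain rfl : a = b := by simpa using hlast'
        exact absurd rfl hne
      | cons z t' =>
        rw [List.isChain_cons_cons] at hc'
        rw [List.getLast?_cons_cons] at hlast'
        have hz := hc'.1.isDyck ha
        have hzb := tamariLE_of_isChain t' z hc'.2 hlast'
        obtain ⟨i, ki, hi, hki, rfl⟩ := (covers_iff ha.1 z).1 hc'.1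
        have hji : j.val ≤ i.val := le_of_tamariLE_decr hi hki hzb hlt
        simp only [List.zipWith_cons_cons]
        rcases hji.lt_or_eq with h | h
        · refine ⟨fun hr' => ?_, Or.inr (List.Lex.rel ?_)⟩
          · have := eq_of_rising t' _ _ hz hc'.2 hlast' hr' j (by rwa [lbl_decr hi hki])
            rw [decr_of_lt a ki h] at this
            omega
          · rw [lbl_decr hasc hk, lbl_decr hi hki]
            exact Or.inl h
        · obtain rfl : j = i := Fin.ext h
          obtain rfl := hk.unique hki
          obtain ⟨h1, h2⟩ := hmin t' hc'.2 hlast'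
          refine ⟨fun hr' => by rw [h1 hr'.tail], ?_⟩
          rcases h2 with h2 | h2
          · exact Or.inl (by rw [h2])
          · exact Or.inr (List.Lex.cons h2)

/-- Every Dyck sequence lies below the zero sequence. -/
theorem tamariLE_zero {m n : ℕ} (N : ℕ) :
    ∀ a : Fin n → ℕ, ∑ j, a j = N → IsDyck m n a → TamariLE m n a 0 := by
  induction N using Nat.strong_induction_on with
  | _ N ih =>
  rintro a rfl ha
  by_cases h0 : a = 0
  · rw [h0]
    exact Relation.ReflTransGen.refl
  · let S : Finset (Fin n) := Finset.univ.filter fun j => a j ≠ 0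
    have hS : S.Nonempty := by
      obtain ⟨j, hj⟩ := Function.ne_iff.1 h0
      exact ⟨j, by simpa [S] using hj⟩
    obtain ⟨j, hjS, hmin⟩ := S.exists_min_image (fun k => k.val) hS
    simp only [S, Finset.mem_filter, Finset.mem_univ, true_and] at hjS hmin
    have hj0 : j.val ≠ 0 := by
      intro h
      have := ha.2 j
      rw [h] at this
      omega
    have hjn := j.isLt
    have hasc : Ascent a j := by
      refine ⟨⟨j.val - 1, by omega⟩, by simp; omega, ?_⟩
      by_contra h
      have := hmin ⟨j.val - 1, by omega⟩ (by omega)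
      simp only at this
      omega
    obtain ⟨k, hk⟩ := exists_primEnd m a j
    have hcov : Covers m n a (decr a j k) := (covers_iff ha.1 _).2 ⟨j, k, hasc, hk, rfl⟩
    exact Relation.ReflTransGen.head hcov (ih _ hcov.sum_lt _ rfl (hcov.isDyck ha))

/-- Every Dyck sequence lies above the sequence `0, m, 2m, …`. -/
theorem mul_tamariLE {m n : ℕ} (N : ℕ) :
    ∀ a : Fin n → ℕ, ∑ j, (m * j.val - a j) = N → IsDyck m n a →
      TamariLE m n (fun j => m * j.val) a := by
  induction N using Nat.strong_induction_on with
  | _ N ih =>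
  rintro a rfl ha
  by_cases h0 : a = fun j => m * j.val
  · rw [← h0]
    exact Relation.ReflTransGen.refl
  · let S : Finset (Fin n) := Finset.univ.filter fun j => a j ≠ m * j.val
    have hS : S.Nonempty := by
      obtain ⟨j, hj⟩ := Function.ne_iff.1 h0
      exact ⟨j, by simpa [S] using hj⟩
    obtain ⟨i, hiS, hmax⟩ := S.exists_max_image (fun k => k.val) hS
    simp only [S, Finset.mem_filter, Finset.mem_univ, true_and] at hiS hmax
    have hi : a i < m * i.val := lt_of_le_of_ne (ha.2 i) hiS
    have hgt : ∀ l : Fin n, i.val < l.val → a l = m * l.val ∧ m * i.val ≤ m * l.val := by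
      intro l hl
      refine ⟨?_, Nat.mul_le_mul_left m hl.le⟩
      by_contra h
      have := hmax l h
      omega
    let a' : Fin n → ℕ := Function.update a i (a i + 1)
    have hself : a' i = a i + 1 := Function.update_self ..
    have hother : ∀ l, l ≠ i → a' l = a l := fun l hl => Function.update_of_ne hl ..
    have hmono : Monotone a' := by
      intro l l' hll
      have h1 := ha.1 hll
      rw [Fin.le_def] at hll
      by_cases hl : l = i
      · subst hl
        by_cases hl' : l' = l
        · rw [hl']
        · have := hgt l' (by have := Fin.val_ne_of_ne hl'; omega)
          rw [hself, hother l' hl']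
          omega
      · rw [hother l hl]
        by_cases hl' : l' = i
        · subst hl'
          omega
        · rwa [hother l' hl']
    have ha' : IsDyck m n a' := by
      refine ⟨hmono, fun l => ?_⟩
      by_cases hl : l = i
      · subst hl
        omega
      · rw [hother l hl]
        exact ha.2 l
    have hi0 : i.val ≠ 0 := by
      intro h
      rw [h] at hi
      omega
    have hin := i.isLt
    have hcov : Covers m n a' a := by
      refine (covers_iff hmono a).2 ⟨i, i, ⟨⟨i.val - 1, by omega⟩, by simp; omega, ?_⟩,
        ⟨le_rfl, by omega, fun l hl => ?_⟩, ?_⟩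
      · have : (⟨i.val - 1, by omega⟩ : Fin n) ≠ i := Fin.ne_of_val_ne (by simp; omega)
        rw [hself, hother _ this]
        exact Nat.lt_succ_of_le (ha.1 (Fin.le_def.2 (by simp)))
      · have := hgt l (by omega)
        rw [hself, hother l (Fin.ne_of_val_ne (by omega))]
        omega
      · funext l
        by_cases hl : l = i
        · subst hl
          rw [decr_self a' le_rfl, hself]
          rfl
        · have := Fin.val_ne_of_ne hl
          rw [decr, if_neg (by omega), hother l hl]
    refine Relation.ReflTransGen.tail (ih _ ?_ a' rfl ha') hcov
    refine Finset.sum_lt_sum (fun l _ => ?_) ⟨i, Finset.mem_univ _, by omega⟩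
    have : a l ≤ a' l := hcov.le l
    omega

/-- `T_n^(m)` is EL-shellable: it is a bounded poset admitting an edge labeling such
that every interval has a unique rising maximal chain, lexicographically least among
all maximal chains of the interval. -/
theorem tamari_EL_shellable (m n : ℕ) (hm : 0 < m) (hn : 0 < n) :
    -- boundedness
    (∃ bot top : Fin n → ℕ, IsDyck m n bot ∧ IsDyck m n top ∧
      ∀ a : Fin n → ℕ, IsDyck m n a →
        TamariLE m n bot a ∧ TamariLE m n a top) ∧
    -- existence of an EL-labeling
    ∃ (Λ : Type) (lt : Λ → Λ → Prop) (f : (Fin n → ℕ) → (Fin n → ℕ) → Λ),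
      ∀ a b : Fin n → ℕ, IsDyck m n a → IsDyck m n b → TamariLE m n a b →
        ∃ c : List (Fin n → ℕ),
          (IsMaxChn m n a b c ∧ (List.zipWith f c c.tail).Chain' lt) ∧
          (∀ c' : List (Fin n → ℕ), IsMaxChn m n a b c' →
            (List.zipWith f c' c'.tail).Chain' lt → c' = c) ∧
          (∀ c' : List (Fin n → ℕ), IsMaxChn m n a b c' →
            List.zipWith f c c.tail = List.zipWith f c' c'.tail ∨
              List.Lex lt (List.zipWith f c c.tail) (List.zipWith f c' c'.tail)) := by
  refine ⟨⟨fun j => m * j.val, 0, ⟨fun i j h => Nat.mul_le_mul_left m h, fun i => le_rfl⟩,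
    ⟨fun i j _ => le_rfl, fun i => Nat.zero_le _⟩,
    fun a ha => ⟨mul_tamariLE _ a rfl ha, tamariLE_zero _ a rfl ha⟩⟩,
    ℕ × ℕ, LblLT, lbl n, fun a b ha hb hab => ?_⟩
  obtain ⟨t, ⟨hc, hlast, hr⟩, hmin⟩ := exists_unique_rising_lex_least hb _ a rfl ha hab
  have hcons : ∀ c', IsMaxChn m n a b c' → ∃ t', c' = a :: t' := fun c' hc' =>
    List.head?_eq_some_iff.1 hc'.2.1
  refine ⟨a :: t, ⟨⟨hc, rfl, hlast⟩, hr⟩, fun c' hc' hr' => ?_, fun c' hc' => ?_⟩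
  · obtain ⟨t', rfl⟩ := hcons c' hc'
    rw [(hmin t' hc'.1 hc'.2.2).1 hr']
  · obtain ⟨t', rfl⟩ := hcons c' hc'
    exact (hmin t' hc'.1 hc'.2.2).2
end

section
/- For every interval [a,b] of the m-Tamari lattice T_n^(m), the Möbius function satisfies μ(a,b) ∈ {-1, 0, 1}. -/
open scoped Classical

/-- The elements of the `m`-Tamari lattice `T_n^(m)`. -/
def Tam (m n : ℕ) : Type := {a : Fin n → ℕ // IsDyck m n a}

/-- `μ` is the Möbius function of `T_n^(m)`. -/
def IsMobius (m n : ℕ) (μ : Tam m n → Tam m n → ℤ) : Prop :=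
  ∀ a b : Tam m n, TamariLE m n a.1 b.1 →
    ∑ᶠ c ∈ {c : Tam m n | TamariLE m n a.1 c.1 ∧ TamariLE m n c.1 b.1}, μ a c =
      if a = b then 1 else 0

/-- The minimal element `(0, m, 2m, …, (n-1)m)` of `T_n^(m)`. -/
def botSeq (m n : ℕ) : Fin n → ℕ := fun i => m * i.val

lemma botSeq_isDyck (m n : ℕ) : IsDyck m n (botSeq m n) :=
  ⟨fun i j h => Nat.mul_le_mul_left m h, fun _ => le_rfl⟩

/-- The maximal element `(0, 0, …, 0)` of `T_n^(m)`. -/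
def topSeq (n : ℕ) : Fin n → ℕ := fun _ => 0

lemma topSeq_isDyck (m n : ℕ) : IsDyck m n (topSeq n) :=
  ⟨monotone_const, fun _ => Nat.zero_le _⟩

/-- The set `D` of indices where two sequences differ and `a` has an ascent. -/
noncomputable def Dset (n : ℕ) (a b : ℕ → ℕ) : Finset ℕ :=
  (Finset.range n).filter (fun j => 1 ≤ j ∧ a j ≠ b j ∧ a (j - 1) < a j)

/-- The quantity `ps(a, j)` from the paper, relative to a set `D` of indices. -/
noncomputable def ps (m : ℕ) (D : Finset ℕ) (a : ℕ → ℕ) (j : ℕ) : ℕ :=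
  (D.filter (fun i => i < j ∧ a j - 1 - a i < m * (j - i) ∧
    ∀ k, i < k → k < j → a k - a i < m * (k - i))).card

section TamariMobius

variable {m n : ℕ}

/-- `j` lies in the primitive subsequence of `a` at position `i`. -/
def InPrim (m : ℕ) {n : ℕ} (a : Fin n → ℕ) (i j : Fin n) : Prop :=
  i ≤ j ∧ ∀ l : Fin n, i < l → l ≤ j → a l + m * i.val < a i + m * l.val

/-- `a` has an ascent at position `i`. -/
def IsAscent {n : ℕ} (a : Fin n → ℕ) (i : Fin n) : Prop :=
  0 < a i ∧ ∀ p : Fin n, p < i → a p < a i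

/-- Decrease the primitive subsequence of `a` at position `i` by one. -/
noncomputable def lowerPrim (m : ℕ) {n : ℕ} (a : Fin n → ℕ) (i : Fin n) : Fin n → ℕ :=
  fun j => if InPrim m a i j then a j - 1 else a j

/-- A description of the `m`-Tamari order by inequalities: the difference `a - b` is nonnegative,
and on each primitive subsequence of `a` it is minimal at the first position. -/
def PrimLE (m : ℕ) {n : ℕ} (a b : Fin n → ℕ) : Prop :=
  (∀ j, b j ≤ a j) ∧ ∀ i j, InPrim m a i j → a i + b j ≤ a j + b i

/-- For `y` above `a`, the condition that `y` is above `lowerPrim m a i`. It only involves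
positions up to `i`. -/
def AtomCond (m : ℕ) {n : ℕ} (a y : Fin n → ℕ) (i : Fin n) : Prop :=
  y i < a i ∧ ∀ p : Fin n, p < i →
    (∀ l : Fin n, p < l → l < i → a l + m * p.val < a p + m * l.val) →
    a i + m * p.val ≤ a p + m * i.val → a p + y i < a i + y p

lemma InPrim.trans {a : Fin n → ℕ} {p i j : Fin n} (h : InPrim m a p i) (h' : InPrim m a i j) :
    InPrim m a p j := by
  refine ⟨h.1.trans h'.1, fun l hpl hlj => ?_⟩
  rcases le_or_gt l i with hli | hil
  · exact h.2 l hpl hli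
  · have h1 := h'.2 l hil hlj
    rcases h.1.eq_or_lt with rfl | hpi
    · exact h1
    · have h2 := h.2 i hpi le_rfl
      omega

lemma InPrim.of_le {a : Fin n → ℕ} {i j l : Fin n} (h : InPrim m a i j) (hil : i ≤ l)
    (hlj : l ≤ j) : InPrim m a i l :=
  ⟨hil, fun q hiq hql => h.2 q hiq (hql.trans hlj)⟩

lemma inPrim_refl (a : Fin n → ℕ) (i : Fin n) : InPrim m a i i :=
  ⟨le_rfl, fun _ h h' => absurd h (not_lt.2 h')⟩

lemma InPrim.mono {a b : Fin n → ℕ} {i j : Fin n} (hab : PrimLE m a b) (h : InPrim m a i j) :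
    InPrim m b i j := by
  refine ⟨h.1, fun l hil hlj => ?_⟩
  have h1 := hab.2 i l (h.of_le hil.le hlj)
  have h2 := h.2 l hil hlj
  omega

lemma PrimLE.refl (a : Fin n → ℕ) : PrimLE m a a :=
  ⟨fun _ => le_rfl, fun _ _ _ => (Nat.add_comm _ _).le⟩

lemma PrimLE.trans {a b c : Fin n → ℕ} (h : PrimLE m a b) (h' : PrimLE m b c) : PrimLE m a c := by
  refine ⟨fun j => (h'.1 j).trans (h.1 j), fun i j hij => ?_⟩
  have h1 := h.2 i j hij
  have h2 := h'.2 i j (hij.mono h)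
  omega

lemma lowerPrim_of_inPrim {a : Fin n → ℕ} {i j : Fin n} (h : InPrim m a i j) :
    lowerPrim m a i j = a j - 1 := if_pos h

lemma lowerPrim_of_not_inPrim {a : Fin n → ℕ} {i j : Fin n} (h : ¬ InPrim m a i j) :
    lowerPrim m a i j = a j := if_neg h

lemma lowerPrim_of_lt {a : Fin n → ℕ} {i j : Fin n} (h : j < i) : lowerPrim m a i j = a j :=
  if_neg fun h' => absurd h'.1 (not_le.2 h)

lemma lowerPrim_self (a : Fin n → ℕ) (i : Fin n) : lowerPrim m a i i = a i - 1 :=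
  if_pos (inPrim_refl a i)

lemma IsAscent.pos_of_le {a : Fin n → ℕ} {i j : Fin n} (h : IsAscent a i) (ha : IsDyck m n a)
    (hij : i ≤ j) : 0 < a j :=
  h.1.trans_le (ha.1 hij)

lemma IsDyck.lowerPrim {a : Fin n → ℕ} {i : Fin n} (ha : IsDyck m n a) (hi : IsAscent a i) :
    IsDyck m n (lowerPrim m a i) := by
  constructor
  · intro p q hpq
    have hm := ha.1 hpq
    by_cases hp : InPrim m a i p <;> by_cases hq : InPrim m a i q
    · rw [lowerPrim_of_inPrim hp, lowerPrim_of_inPrim hq]; omega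
    · rw [lowerPrim_of_inPrim hp, lowerPrim_of_not_inPrim hq]; omega
    · have hpi : p < i := lt_of_not_ge fun h => hp (hq.of_le h hpq)
      have h1 := hi.2 p hpi
      have h2 := ha.1 hq.1
      rw [lowerPrim_of_not_inPrim hp, lowerPrim_of_inPrim hq]; omega
    · rw [lowerPrim_of_not_inPrim hp, lowerPrim_of_not_inPrim hq]; exact hm
  · intro j
    have := ha.2 j
    unfold _root_.lowerPrim
    split_ifs <;> omega

lemma primLE_lowerPrim {a : Fin n → ℕ} {i : Fin n} (ha : IsDyck m n a) (hi : IsAscent a i) :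
    PrimLE m a (lowerPrim m a i) := by
  refine ⟨fun j => by unfold lowerPrim; split_ifs <;> omega, fun p j hpj => ?_⟩
  by_cases hp : InPrim m a i p
  · have h1 := hi.pos_of_le ha hp.1
    have h2 := hi.pos_of_le ha (hp.1.trans hpj.1)
    rw [lowerPrim_of_inPrim hp, lowerPrim_of_inPrim (hp.trans hpj)]
    omega
  · rw [lowerPrim_of_not_inPrim hp]
    unfold lowerPrim
    split_ifs <;> omega

lemma primLE_lowerPrim_iff {a y : Fin n → ℕ} {i : Fin n} (ha : IsDyck m n a) (hi : IsAscent a i)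
    (hay : PrimLE m a y) : PrimLE m (lowerPrim m a i) y ↔ AtomCond m a y i := by
  have hi0 := hi.1
  constructor
  · intro h
    have h1 := h.1 i
    rw [lowerPrim_self] at h1
    refine ⟨by omega, fun p hp hl hpi => ?_⟩
    have h2 := h.2 p i ⟨hp.le, fun l hpl hli => ?_⟩
    · rw [lowerPrim_of_lt hp, lowerPrim_self] at h2
      omega
    · rw [lowerPrim_of_lt hp]
      rcases hli.eq_or_lt with rfl | hli
      · rw [lowerPrim_self]; omega
      · rw [lowerPrim_of_lt hli]; exact hl l hpl hli
  · rintro ⟨h0, hQ⟩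
    refine ⟨fun j => ?_, fun p j hpj => ?_⟩
    · by_cases hj : InPrim m a i j
      · have := hay.2 i j hj
        rw [lowerPrim_of_inPrim hj]; omega
      · rw [lowerPrim_of_not_inPrim hj]; exact hay.1 j
    have hle : ∀ l, a l ≤ lowerPrim m a i l + 1 := fun l => by
      unfold lowerPrim; split_ifs <;> omega
    by_cases hp : InPrim m a i p
    · have hp0 := hi.pos_of_le ha hp.1
      have hpj' : InPrim m a p j := ⟨hpj.1, fun l hpl hlj => by
        have h1 := hpj.2 l hpl hlj
        rw [lowerPrim_of_inPrim hp] at h1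
        have := hle l
        omega⟩
      have hj := hp.trans hpj'
      have := hi.pos_of_le ha hj.1
      have := hay.2 p j hpj'
      rw [lowerPrim_of_inPrim hp, lowerPrim_of_inPrim hj]
      omega
    · by_cases hj : InPrim m a i j
      · have hpi : p < i := lt_of_not_ge fun h => hp (hj.of_le h hpj.1)
        have := hi.pos_of_le ha hj.1
        have h1 := hQ p hpi (fun l hpl hli => by
          have := hpj.2 l hpl (hli.le.trans hj.1)
          rwa [lowerPrim_of_lt hpi, lowerPrim_of_lt hli] at this) (by
          have := hpj.2 i hpi hj.1
          rw [lowerPrim_of_lt hpi, lowerPrim_self] at this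
          omega)
        have h2 := hay.2 i j hj
        rw [lowerPrim_of_lt hpi, lowerPrim_of_inPrim hj]
        omega
      · rw [lowerPrim_of_not_inPrim hp, lowerPrim_of_not_inPrim hj]
        refine hay.2 p j ⟨hpj.1, fun l hpl hlj => ?_⟩
        by_cases hl : InPrim m a i l
        · have hpi : p < i := lt_of_not_ge fun h => hp (hl.of_le h hpl.le)
          have hij : i ≤ j := hl.1.trans hlj
          obtain ⟨r, hir, hrj, hr⟩ : ∃ r, i < r ∧ r ≤ j ∧ a i + m * r.val ≤ a r + m * i.val := by
            by_contra! hcon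
            exact hj ⟨hij, hcon⟩
          have hr' : ¬ InPrim m a i r := fun h => by
            have := h.2 r hir le_rfl
            omega
          have h1 := hpj.2 r (hpi.trans hir) hrj
          rw [lowerPrim_of_lt hpi, lowerPrim_of_not_inPrim hr'] at h1
          rcases hl.1.eq_or_lt with rfl | hil
          · omega
          · have := hl.2 l hil le_rfl
            omega
        · have h1 := hpj.2 l hpl hlj
          rwa [lowerPrim_of_not_inPrim hp, lowerPrim_of_not_inPrim hl] at h1

lemma exists_atomCond {a y : Fin n → ℕ} (hy : IsDyck m n y) (hay : PrimLE m a y) (hne : a ≠ y) :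
    ∃ i, IsAscent a i ∧ AtomCond m a y i := by
  have hex : ∃ i, y i < a i := by
    by_contra! h
    exact hne (funext fun i => le_antisymm (h i) (hay.1 i))
  obtain ⟨i, hi, hmin⟩ := WellFounded.has_min (wellFounded_lt (α := Fin n)) {i | y i < a i} hex
  have hi : y i < a i := hi
  have heq : ∀ p, p < i → a p = y p := fun p hp =>
    le_antisymm (not_lt.1 fun h => hmin p h hp) (hay.1 p)
  refine ⟨i, ⟨by omega, fun p hp => ?_⟩, hi, fun p hp _ _ => ?_⟩
  · have := hy.1 hp.le
    have := heq p hp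
    omega
  · have := heq p hp
    omega

lemma covers_lowerPrim {a : Fin n → ℕ} {i : Fin n} (ha : IsDyck m n a) (hi : IsAscent a i) :
    Covers m n a (lowerPrim m a i) := by
  obtain ⟨i, hin⟩ := i
  obtain _ | i := i
  · have h1 := ha.2 ⟨0, hin⟩
    have h2 := hi.1
    simp only [Nat.mul_zero] at h1
    omega
  obtain ⟨k, hk, hmax⟩ := (Set.toFinite {k | InPrim m a ⟨i + 1, hin⟩ k}).exists_maximal
    ⟨_, inPrim_refl a ⟨i + 1, hin⟩⟩
  have hk : InPrim m a ⟨i + 1, hin⟩ k := hk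
  refine ⟨i, hin, k, hi.2 _ (by simp [Fin.lt_def]), ⟨hk.1, fun j hij hjk => ?_, ?_⟩, ?_⟩
  · have h1 := hk.2 j hij hjk
    have h2 := ha.1 hij.le
    rw [Nat.mul_sub]
    simp only at h1 ⊢
    omega
  · by_contra! hcon
    obtain ⟨h1, h2⟩ := hcon
    have hlt : k.val + 1 < n := by omega
    have h3 := h2 hlt
    have hik : i + 1 ≤ k.val := hk.1
    have hin' : InPrim m a ⟨i + 1, hin⟩ ⟨k.val + 1, hlt⟩ := by
      refine ⟨by simp only [Fin.le_def]; omega, fun l hil hlk => ?_⟩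
      rcases hlk.eq_or_lt with rfl | hlk
      · have h4 : m * (i + 1) ≤ m * (k.val + 1) := Nat.mul_le_mul_left m (by omega)
        rw [Nat.mul_sub] at h3
        simp only at h3 h4 ⊢
        omega
      · exact hk.2 l hil (by simp only [Fin.lt_def] at hlk; simp only [Fin.le_def]; omega)
    have h5 := hmax hin' (by simp [Fin.le_def])
    simp only [Fin.le_def] at h5
    omega
  · funext j
    have : InPrim m a ⟨i + 1, hin⟩ j ↔ (⟨i + 1, hin⟩ : Fin n) ≤ j ∧ j ≤ k :=
      ⟨fun h => ⟨h.1, (le_total j k).elim id fun hkj => hmax h hkj⟩, fun h => hk.of_le h.1 h.2⟩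
    simp only [lowerPrim, this]

lemma Covers.exists_lowerPrim {a b : Fin n → ℕ} (hm : 0 < m) (ha : IsDyck m n a)
    (h : Covers m n a b) : ∃ i, IsAscent a i ∧ b = lowerPrim m a i := by
  obtain ⟨i, hin, k, hasc, ⟨hik, hprim, hend⟩, rfl⟩ := h
  refine ⟨⟨i + 1, hin⟩, ⟨by omega, fun p hp => ?_⟩, ?_⟩
  · refine (ha.1 (?_ : p ≤ ⟨i, Nat.lt_of_succ_lt hin⟩)).trans_lt hasc
    simp only [Fin.lt_def] at hp
    simp only [Fin.le_def]
    omega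
  · have hk : InPrim m a ⟨i + 1, hin⟩ k := ⟨hik, fun l hil hlk => by
      have h1 := hprim l hil hlk
      have h2 : m * (i + 1) ≤ m * l.val := Nat.mul_le_mul_left m hil.le
      rw [Nat.mul_sub] at h1
      simp only at h1 ⊢
      omega⟩
    funext j
    have : InPrim m a ⟨i + 1, hin⟩ j ↔ (⟨i + 1, hin⟩ : Fin n) ≤ j ∧ j ≤ k := by
      refine ⟨fun h => ⟨h.1, not_lt.1 fun hkj => ?_⟩, fun h => hk.of_le h.1 h.2⟩
      have hkj' : k.val < j.val := hkj
      have hik' : i + 1 ≤ k.val := hik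
      rcases hend with hend | ⟨hlt, hend⟩
      · omega
      · have h1 := h.2 ⟨k.val + 1, hlt⟩ (by simp only [Fin.lt_def]; omega)
          (by simp only [Fin.le_def]; omega)
        have h2 : m * (i + 1) < m * (k.val + 1) := Nat.mul_lt_mul_of_pos_left (by omega) hm
        rw [Nat.mul_sub] at hend
        simp only at h1 hend
        omega
    simp only [lowerPrim, this]

lemma TamariLE.isDyck_and_primLE {a b : Fin n → ℕ} (hm : 0 < m) (ha : IsDyck m n a)
    (h : TamariLE m n a b) : IsDyck m n b ∧ PrimLE m a b := by
  induction h with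
  | refl => exact ⟨ha, PrimLE.refl a⟩
  | tail _ hc ih =>
    obtain ⟨i, hi, rfl⟩ := hc.exists_lowerPrim hm ih.1
    exact ⟨ih.1.lowerPrim hi, ih.2.trans (primLE_lowerPrim ih.1 hi)⟩

lemma sum_lowerPrim_lt {a : Fin n → ℕ} {i : Fin n} (ha : IsDyck m n a) (hi : IsAscent a i) :
    ∑ j, lowerPrim m a i j < ∑ j, a j := by
  refine Finset.sum_lt_sum (fun j _ => (primLE_lowerPrim ha hi).1 j) ⟨i, Finset.mem_univ i, ?_⟩
  have := hi.1
  rw [lowerPrim_self]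
  omega

lemma PrimLE.tamariLE {y : Fin n → ℕ} (hy : IsDyck m n y) {a : Fin n → ℕ} (ha : IsDyck m n a)
    (hay : PrimLE m a y) : TamariLE m n a y := by
  induction hs : ∑ j, a j using Nat.strong_induction_on generalizing a with
  | _ s ih =>
    by_cases hne : a = y
    · subst hne
      exact Relation.ReflTransGen.refl
    · obtain ⟨i, hi, hc⟩ := exists_atomCond hy hay hne
      exact Relation.ReflTransGen.head (covers_lowerPrim ha hi)
        (ih _ (hs ▸ sum_lowerPrim_lt ha hi) (ha.lowerPrim hi)
          ((primLE_lowerPrim_iff ha hi hay).2 hc) rfl)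

lemma tamariLE_iff_primLE (hm : 0 < m) (a b : Tam m n) :
    TamariLE m n a.1 b.1 ↔ PrimLE m a.1 b.1 :=
  ⟨fun h => (h.isDyck_and_primLE hm a.2).2, fun h => h.tamariLE b.2 a.2⟩

/-- The alternating sum of the indicators of the elements obtained from `a` by lowering the
primitive subsequences at some of the ascents at positions less than `k`, from right to left. -/
noncomputable def ascentSum (m : ℕ) {n : ℕ} : ℕ → (Fin n → ℕ) → (Fin n → ℕ) → ℤ
  | 0, a, c => if c = a then 1 else 0
  | k + 1, a, c => ascentSum m k a c -
      if h : ∃ hk : k < n, IsAscent a ⟨k, hk⟩ then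
        ascentSum m k (lowerPrim m a ⟨k, h.choose⟩) c
      else 0

lemma ascentSum_succ_of_isAscent {a : Fin n → ℕ} {k : ℕ} (hk : k < n) (h : IsAscent a ⟨k, hk⟩)
    (c : Fin n → ℕ) :
    ascentSum m (k + 1) a c = ascentSum m k a c - ascentSum m k (lowerPrim m a ⟨k, hk⟩) c := by
  rw [ascentSum, dif_pos ⟨hk, h⟩]

lemma ascentSum_succ_of_not {a : Fin n → ℕ} {k : ℕ} (h : ¬ ∃ hk : k < n, IsAscent a ⟨k, hk⟩)
    (c : Fin n → ℕ) : ascentSum m (k + 1) a c = ascentSum m k a c := by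
  rw [ascentSum, dif_neg h, sub_zero]

lemma isAscent_congr {a b : Fin n → ℕ} {i : Fin n} (h : ∀ j ≤ i, a j = b j) :
    IsAscent a i ↔ IsAscent b i := by
  unfold IsAscent
  rw [h i le_rfl]
  exact and_congr_right fun _ => forall₂_congr fun p hp => by rw [h p hp.le]

lemma atomCond_congr {a b y : Fin n → ℕ} {i : Fin n} (h : ∀ j ≤ i, a j = b j) :
    AtomCond m a y i ↔ AtomCond m b y i := by
  unfold AtomCond
  rw [h i le_rfl]
  refine and_congr_right fun _ => forall₂_congr fun p hp => ?_
  rw [h p hp.le]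
  refine imp_congr_left (forall₃_congr fun l _ hl => ?_)
  rw [h l hl.le]

lemma primLE_of_ascentSum_ne_zero {k : ℕ} {a c : Fin n → ℕ} (ha : IsDyck m n a)
    (h : ascentSum m k a c ≠ 0) : PrimLE m a c := by
  induction k generalizing a with
  | zero =>
    obtain rfl : c = a := by
      by_contra hca
      exact h (if_neg hca)
    exact PrimLE.refl c
  | succ k ih =>
    by_cases hk : ∃ hk : k < n, IsAscent a ⟨k, hk⟩
    · obtain ⟨hk, hi⟩ := hk
      rw [ascentSum_succ_of_isAscent hk hi] at h
      by_cases h0 : ascentSum m k a c = 0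
      · exact (primLE_lowerPrim ha hi).trans
          (ih (ha.lowerPrim hi) fun h1 => h (by rw [h0, h1, sub_zero]))
      · exact ih ha h0
    · rw [ascentSum_succ_of_not hk] at h
      exact ih ha h

/-- Sequences that first differ after an ascent `i` still differ after lowering at `i`. -/
lemma lowerPrim_ne {a b : Fin n → ℕ} {i : Fin n} (ha : IsDyck m n a) (hb : IsDyck m n b)
    (hi : IsAscent a i) (hi' : IsAscent b i) (h : ∀ j ≤ i, a j = b j) (hne : a ≠ b) :
    lowerPrim m a i ≠ lowerPrim m b i := by
  obtain ⟨q, hq, hmin⟩ := WellFounded.has_min (wellFounded_lt (α := Fin n)) {q | a q ≠ b q}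
    (Function.ne_iff.1 hne)
  have hq : a q ≠ b q := hq
  have heq : ∀ p, p < q → a p = b p := fun p hp => not_not.1 fun h => hmin p h hp
  have hiq : i < q := lt_of_not_ge fun hqi => hq (h q hqi)
  have key : ∀ a b : Fin n → ℕ, IsAscent a i → IsDyck m n a → (∀ p, p < q → a p = b p) →
      a q < b q → lowerPrim m a i q < lowerPrim m b i q := by
    intro a b hi ha heq hlt
    have hpos := hi.pos_of_le ha hiq.le
    by_cases hbq : InPrim m b i q
    · have haq : InPrim m a i q := ⟨hbq.1, fun l hil hlq => by
        have h1 := hbq.2 l hil hlq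
        have h2 := heq i hiq
        rcases hlq.eq_or_lt with rfl | hlq
        · omega
        · have h3 := heq l hlq
          omega⟩
      rw [lowerPrim_of_inPrim haq, lowerPrim_of_inPrim hbq]
      omega
    · rw [lowerPrim_of_not_inPrim hbq]
      unfold lowerPrim
      split_ifs <;> omega
  intro hcontra
  have hcq := congrFun hcontra q
  rcases lt_or_gt_of_ne hq with hlt | hlt
  · exact (key a b hi ha heq hlt).ne hcq
  · exact (key b a hi' hb (fun p hp => (heq p hp).symm) hlt).ne' hcq

lemma ascentSum_eq_zero_or {k : ℕ} {a b : Fin n → ℕ} (ha : IsDyck m n a) (hb : IsDyck m n b)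
    (h : ∀ j : Fin n, j.val < k → a j = b j) (hne : a ≠ b) (c : Fin n → ℕ) :
    ascentSum m k a c = 0 ∨ ascentSum m k b c = 0 := by
  induction k generalizing a b with
  | zero =>
    by_cases hca : c = a
    · exact Or.inr (if_neg (hca ▸ hne))
    · exact Or.inl (if_neg hca)
  | succ k ih =>
    have hlt : ∀ j : Fin n, j.val < k → a j = b j := fun j hj => h j (by omega)
    have hab := ih ha hb hlt hne
    by_cases hk : ∃ hk : k < n, IsAscent a ⟨k, hk⟩
    · obtain ⟨hk, hi⟩ := hk
      have hle : ∀ j ≤ (⟨k, hk⟩ : Fin n), a j = b j := fun j hj => h j (Nat.lt_succ_of_le hj)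
      have hi' := (isAscent_congr hle).1 hi
      have hself : ∀ x z : Fin n → ℕ, IsAscent x ⟨k, hk⟩ → x ⟨k, hk⟩ = z ⟨k, hk⟩ →
          lowerPrim m x ⟨k, hk⟩ ≠ z := fun x z hx hxz he => by
        have h1 := congrFun he ⟨k, hk⟩
        have h2 := hx.1
        rw [lowerPrim_self] at h1
        omega
      have hagree : ∀ x : Fin n → ℕ, ∀ j : Fin n, j.val < k → lowerPrim m x ⟨k, hk⟩ j = x j :=
        fun x j hj => lowerPrim_of_lt hj
      rw [ascentSum_succ_of_isAscent hk hi, ascentSum_succ_of_isAscent hk hi']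
      have h1 := ih (ha.lowerPrim hi) (hb.lowerPrim hi')
        (fun j hj => by rw [hagree a j hj, hagree b j hj, hlt j hj])
        (lowerPrim_ne ha hb hi hi' hle hne)
      have h2 := ih (ha.lowerPrim hi) hb (fun j hj => by rw [hagree a j hj, hlt j hj])
        (hself a b hi (hle _ le_rfl))
      have h3 := ih (hb.lowerPrim hi') ha (fun j hj => by rw [hagree b j hj, hlt j hj])
        (hself b a hi' (hle _ le_rfl).symm)
      omega
    · have hk' : ¬ ∃ hk : k < n, IsAscent b ⟨k, hk⟩ := fun ⟨hkn, hi⟩ =>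
        hk ⟨hkn, (isAscent_congr fun j hj => h j (Nat.lt_succ_of_le hj)).2 hi⟩
      rw [ascentSum_succ_of_not hk, ascentSum_succ_of_not hk']
      exact hab

lemma ascentSum_values {k : ℕ} {a : Fin n → ℕ} (ha : IsDyck m n a) (c : Fin n → ℕ) :
    ascentSum m k a c = -1 ∨ ascentSum m k a c = 0 ∨ ascentSum m k a c = 1 := by
  induction k generalizing a with
  | zero =>
    unfold ascentSum
    split_ifs <;> simp
  | succ k ih =>
    by_cases hk : ∃ hk : k < n, IsAscent a ⟨k, hk⟩
    · obtain ⟨hk, hi⟩ := hk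
      have h1 := ih ha
      have h2 := ih (ha.lowerPrim hi)
      have h3 := ascentSum_eq_zero_or (k := k) ha (ha.lowerPrim hi)
        (fun j hj => (lowerPrim_of_lt (i := ⟨k, hk⟩) hj).symm) (fun he => by
          have h4 := congrFun he ⟨k, hk⟩
          have h5 := hi.1
          rw [lowerPrim_self] at h4
          omega) c
      rw [ascentSum_succ_of_isAscent hk hi]
      omega
    · rw [ascentSum_succ_of_not hk]
      exact ih ha

instance : Finite (Tam m n) := by
  refine Finite.of_injective
    (fun (a : Tam m n) (i : Fin n) => (⟨a.1 i, Nat.lt_succ_of_le (a.2.2 i)⟩ : Fin (m * i.val + 1)))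
    fun a b h => Subtype.ext (funext fun i => ?_)
  exact congrArg Fin.val (congrFun h i)

noncomputable instance : Fintype (Tam m n) := Fintype.ofFinite _

lemma sum_ascentSum (k : ℕ) {a : Fin n → ℕ} (ha : IsDyck m n a) (y : Fin n → ℕ) :
    ∑ c : Tam m n, (if PrimLE m c.1 y then ascentSum m k a c.1 else 0) =
      if PrimLE m a y ∧ ∀ i : Fin n, i.val < k → ¬ (IsAscent a i ∧ AtomCond m a y i)
        then 1 else 0 := by
  induction k generalizing a with
  | zero =>
    refine (Finset.sum_eq_single (⟨a, ha⟩ : Tam m n) ?_ ?_).trans ?_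
    · intro c _ hc
      have : c.1 ≠ a := fun h => hc (Subtype.ext h)
      simp [ascentSum, this]
    · exact fun h => absurd (Finset.mem_univ (α := Tam m n) _) h
    · simp [ascentSum]
  | succ k ih =>
    by_cases hk : ∃ hk : k < n, IsAscent a ⟨k, hk⟩
    · obtain ⟨hk, hi⟩ := hk
      have hsplit : ∀ c : Tam m n, (if PrimLE m c.1 y then ascentSum m (k + 1) a c.1 else 0) =
          (if PrimLE m c.1 y then ascentSum m k a c.1 else 0) -
          (if PrimLE m c.1 y then ascentSum m k (lowerPrim m a ⟨k, hk⟩) c.1 else 0) := fun c => by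
        rw [ascentSum_succ_of_isAscent hk hi]
        split_ifs <;> simp
      simp only [hsplit, Finset.sum_sub_distrib, ih ha, ih (ha.lowerPrim hi)]
      have hcond : (∀ i : Fin n, i.val < k → ¬ (IsAscent (lowerPrim m a ⟨k, hk⟩) i ∧
            AtomCond m (lowerPrim m a ⟨k, hk⟩) y i)) ↔
          ∀ i : Fin n, i.val < k → ¬ (IsAscent a i ∧ AtomCond m a y i) := by
        refine forall₂_congr fun i hik => ?_
        have hag : ∀ j ≤ i, lowerPrim m a ⟨k, hk⟩ j = a j := fun j hj =>
          lowerPrim_of_lt (lt_of_le_of_lt hj hik)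
        rw [isAscent_congr hag, atomCond_congr hag]
      have hsucc : (∀ i : Fin n, i.val < k + 1 → ¬ (IsAscent a i ∧ AtomCond m a y i)) ↔
          (∀ i : Fin n, i.val < k → ¬ (IsAscent a i ∧ AtomCond m a y i)) ∧
            ¬ AtomCond m a y ⟨k, hk⟩ := by
        refine ⟨fun h => ⟨fun i hik => h i (by omega), fun hc => h ⟨k, hk⟩ (by simp) ⟨hi, hc⟩⟩,
          fun h i hik => ?_⟩
        rcases (Nat.lt_succ_iff_lt_or_eq.1 hik) with hik | hik
        · exact h.1 i hik
        · obtain rfl : i = ⟨k, hk⟩ := Fin.ext hik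
          exact fun hc => h.2 hc.2
      simp only [hcond, hsucc]
      by_cases hay : PrimLE m a y
      · simp only [primLE_lowerPrim_iff ha hi hay, hay, true_and]
        split_ifs <;> simp_all
      · have : ¬ PrimLE m (lowerPrim m a ⟨k, hk⟩) y := fun h =>
          hay ((primLE_lowerPrim ha hi).trans h)
        simp [hay, this]
    · simp only [ascentSum_succ_of_not hk, ih ha]
      have : (∀ i : Fin n, i.val < k → ¬ (IsAscent a i ∧ AtomCond m a y i)) ↔
          ∀ i : Fin n, i.val < k + 1 → ¬ (IsAscent a i ∧ AtomCond m a y i) := by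
        refine ⟨fun h i hik => ?_, fun h i hik => h i (by omega)⟩
        rcases (Nat.lt_succ_iff_lt_or_eq.1 hik) with hik | hik
        · exact h i hik
        · subst hik
          exact fun hc => hk ⟨i.2, hc.1⟩
      simp only [this]

lemma sum_ascentSum_interval (a b : Tam m n) (hab : PrimLE m a.1 b.1) :
    ∑ c : Tam m n, (if PrimLE m a.1 c.1 ∧ PrimLE m c.1 b.1 then ascentSum m n a.1 c.1 else 0) =
      if a = b then 1 else 0 := by
  have h1 : ∀ c : Tam m n,
      (if PrimLE m a.1 c.1 ∧ PrimLE m c.1 b.1 then ascentSum m n a.1 c.1 else 0) =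
        if PrimLE m c.1 b.1 then ascentSum m n a.1 c.1 else 0 := fun c => by
    by_cases h0 : ascentSum m n a.1 c.1 = 0
    · simp [h0]
    · simp [primLE_of_ascentSum_ne_zero a.2 h0]
  simp only [h1, sum_ascentSum n a.2]
  refine if_congr ⟨fun h => ?_, ?_⟩ rfl rfl
  · by_contra hne
    obtain ⟨i, hi⟩ := exists_atomCond b.2 hab fun he => hne (Subtype.ext he)
    exact h.2 i i.2 hi
  · rintro rfl
    exact ⟨hab, fun i _ hi => lt_irrefl _ hi.2.1⟩

/-- The Möbius function of the `m`-Tamari lattice as an alternating sum over sets of ascents. -/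
lemma IsMobius.eq_ascentSum (hm : 0 < m) {μ : Tam m n → Tam m n → ℤ} (hμ : IsMobius m n μ)
    (a b : Tam m n) (hab : PrimLE m a.1 b.1) : μ a b = ascentSum m n a.1 b.1 := by
  induction hs : ∑ j, a.1 j - ∑ j, b.1 j using Nat.strong_induction_on generalizing b with
  | _ s ih =>
    have h1 := hμ a b ((tamariLE_iff_primLE hm a b).2 hab)
    rw [finsum_mem_def, finsum_eq_sum_of_fintype] at h1
    simp only [Set.indicator_apply, Set.mem_ofPred_eq, tamariLE_iff_primLE hm] at h1
    rw [← sum_ascentSum_interval a b hab, ← sub_eq_zero, ← Finset.sum_sub_distrib,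
      Finset.sum_eq_single b] at h1
    · simp only [hab, PrimLE.refl, and_self, if_true] at h1
      omega
    · intro c _ hcb
      by_cases hc : PrimLE m a.1 c.1 ∧ PrimLE m c.1 b.1
      · rw [if_pos hc, if_pos hc, sub_eq_zero]
        refine ih _ ?_ c hc.1 rfl
        have h2 : ∑ j, c.1 j ≤ ∑ j, a.1 j := Finset.sum_le_sum fun j _ => hc.1.1 j
        have h3 : ∑ j, b.1 j < ∑ j, c.1 j := by
          obtain ⟨j, hj⟩ := Function.ne_iff.1 fun he : c.1 = b.1 => hcb (Subtype.ext he)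
          exact Finset.sum_lt_sum (fun j _ => hc.2.1 j)
            ⟨j, Finset.mem_univ j, lt_of_le_of_ne (hc.2.1 j) hj.symm⟩
        omega
      · rw [if_neg hc, if_neg hc, sub_zero]
    · simp

end TamariMobius

/-- The Möbius function of `T_n^(m)` only takes the values `-1`, `0`, `1`. -/
theorem tamari_mobius_values (m n : ℕ) (hm : 0 < m) (hn : 0 < n)
    (μ : Tam m n → Tam m n → ℤ) (hμ : IsMobius m n μ)
    (a b : Tam m n) (hab : TamariLE m n a.1 b.1) :
    μ a b = -1 ∨ μ a b = 0 ∨ μ a b = 1 := by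
  have h := (tamariLE_iff_primLE hm a b).1 hab
  rw [hμ.eq_ascentSum hm a b h]
  exact ascentSum_values a.2 b.1
end
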